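/- Let K be an infinite field and V a finite-dimensional K-vector space. For every subset A of V there exists a unique finite set 𝒮 of linear subspaces of V, pairwise incomparable with respect to inclusion, such that A ⊆ ⋃𝒮 and ⋃𝒮 ⊆ ⋃𝒯 for every finite set 𝒯 of linear subspaces of V with A ⊆ ⋃𝒯. -/

import Mathlib

/-- A subspace over an infinite field contained in a finite union of subspaces is contained in
one of them. -/
theorem Subspace.exists_le_of_subset_biUnion {K V : Type*} [Field K] [Infinite K]
    [AddCommGroup V] [Module K V] {S : Submodule K V} {𝒯 : Finset (Submodule K V)}
    (h : (S : Set V) ⊆ ⋃ T ∈ 𝒯, (T : Set V)) : ∃ T ∈ 𝒯, S ≤ T := by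
  have hcover : ⋃ T : 𝒯, ((T : Submodule K V).comap S.subtype : Set S) = Set.univ := by
    refine Set.eq_univ_of_forall fun x ↦ ?_
    obtain ⟨T, hT, hx⟩ := Set.mem_iUnion₂.mp (h x.2)
    exact Set.mem_iUnion.mpr ⟨⟨T, hT⟩, hx⟩
  obtain ⟨T, hT⟩ := Subspace.exists_eq_top_of_iUnion_eq_univ hcover
  exact ⟨T, T.2, Submodule.comap_subtype_eq_top.mp hT⟩

/-- In an Artinian module, the part of a set lying in a given submodule has a minimal cover by
finitely many submodules. -/
theorem Submodule.exists_minimal_finset_cover_inter {R M : Type*} [Ring R] [AddCommGroup M]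
    [Module R M] [IsArtinian R M] (A : Set M) (W : Submodule R M) :
    ∃ 𝒮 : Finset (Submodule R M), (A ∩ W ⊆ ⋃ S ∈ 𝒮, (S : Set M)) ∧
      ∀ 𝒯 : Finset (Submodule R M), (A ∩ W ⊆ ⋃ T ∈ 𝒯, (T : Set M)) →
        (⋃ S ∈ 𝒮, (S : Set M)) ⊆ ⋃ T ∈ 𝒯, (T : Set M) := by
  classical
  induction W using WellFoundedLT.induction with
  | _ W ih =>
    by_cases hW : ∃ 𝒰 : Finset (Submodule R M), (∀ U ∈ 𝒰, U < W) ∧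
        A ∩ W ⊆ ⋃ U ∈ 𝒰, (U : Set M)
    · obtain ⟨𝒰, hlt, hcover⟩ := hW
      choose! F hF hFmin using ih
      refine ⟨𝒰.biUnion F, fun x hx ↦ ?_, fun 𝒯 h𝒯 x hx ↦ ?_⟩
      · obtain ⟨U, hU, hxU⟩ := Set.mem_iUnion₂.mp (hcover hx)
        obtain ⟨S, hS, hxS⟩ := Set.mem_iUnion₂.mp (hF U (hlt U hU) ⟨hx.1, hxU⟩)
        exact Set.mem_iUnion₂.mpr ⟨S, Finset.mem_biUnion.mpr ⟨U, hU, hS⟩, hxS⟩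
      · obtain ⟨S, hS, hxS⟩ := Set.mem_iUnion₂.mp hx
        obtain ⟨U, hU, hSU⟩ := Finset.mem_biUnion.mp hS
        exact hFmin U (hlt U hU) 𝒯
          (fun y hy ↦ h𝒯 ⟨hy.1, (hlt U hU).le hy.2⟩) (Set.mem_iUnion₂.mpr ⟨S, hSU, hxS⟩)
    · push Not at hW
      refine ⟨{W}, by simp, fun 𝒯 h𝒯 ↦ ?_⟩
      obtain ⟨T, hT, hWT⟩ : ∃ T ∈ 𝒯, W ≤ T := by
        by_contra! hnot
        refine hW (𝒯.image (W ⊓ ·)) ?_ fun x hx ↦ ?_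
        · simpa using hnot
        · obtain ⟨T, hT, hxT⟩ := Set.mem_iUnion₂.mp (h𝒯 hx)
          exact Set.mem_iUnion₂.mpr ⟨W ⊓ T, Finset.mem_image_of_mem _ hT, hx.2, hxT⟩
      exact fun x hx ↦ Set.mem_iUnion₂.mpr ⟨T, hT, hWT (by simpa using hx)⟩

/-- A finite union of submodules is the union of finitely many pairwise incomparable ones. -/
theorem Submodule.exists_incomparable_biUnion_eq {R M : Type*} [Semiring R] [AddCommMonoid M]
    [Module R M] (𝒮 : Finset (Submodule R M)) :
    ∃ 𝒮' : Finset (Submodule R M), (∀ S₁ ∈ 𝒮', ∀ S₂ ∈ 𝒮', S₁ ≤ S₂ → S₁ = S₂) ∧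
      ⋃ S ∈ 𝒮', (S : Set M) = ⋃ S ∈ 𝒮, (S : Set M) := by
  classical
  refine ⟨𝒮.filter (Maximal (· ∈ 𝒮)), fun S₁ h₁ S₂ h₂ h ↦ ?_, subset_antisymm ?_ ?_⟩
  · exact (Finset.mem_filter.mp h₁).2.eq_of_le (Finset.mem_filter.mp h₂).1 h
  · exact Set.biUnion_subset_biUnion_left (Finset.filter_subset _ _)
  · refine Set.iUnion₂_subset fun S hS x hx ↦ ?_
    obtain ⟨T, hST, hT⟩ := 𝒮.exists_le_maximal hS
    exact Set.mem_iUnion₂.mpr ⟨T, Finset.mem_filter.mpr ⟨hT.prop, hT⟩, hST hx⟩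

/-- Over an infinite field, a finite set of pairwise incomparable subspaces is contained in any
finite set of subspaces with the same union. -/
theorem Subspace.subset_of_biUnion_eq_of_incomparable {K V : Type*} [Field K] [Infinite K]
    [AddCommGroup V] [Module K V] {𝒮 𝒯 : Finset (Submodule K V)}
    (h𝒮 : ∀ S₁ ∈ 𝒮, ∀ S₂ ∈ 𝒮, S₁ ≤ S₂ → S₁ = S₂)
    (h : ⋃ S ∈ 𝒮, (S : Set V) = ⋃ T ∈ 𝒯, (T : Set V)) : 𝒮 ⊆ 𝒯 := by
  intro S hS
  obtain ⟨T, hT, hST⟩ := exists_le_of_subset_biUnion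
    ((Set.subset_biUnion_of_mem (u := fun S : Submodule K V ↦ (S : Set V)) hS).trans h.subset)
  obtain ⟨S', hS', hTS'⟩ := exists_le_of_subset_biUnion
    ((Set.subset_biUnion_of_mem (u := fun S : Submodule K V ↦ (S : Set V)) hT).trans h.superset)
  obtain rfl := h𝒮 S hS S' hS' (hST.trans hTS')
  exact le_antisymm hST hTS' ▸ hT

/-- Over an infinite field, for every subset `A` of a finite-dimensional vector space
`V` there is a unique finite set `𝒮` of linear subspaces, pairwise incomparable with
respect to inclusion, such that `A ⊆ ⋃ 𝒮` and `⋃ 𝒮 ⊆ ⋃ 𝒯` for every finite set `𝒯`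
of subspaces with `A ⊆ ⋃ 𝒯`. -/
theorem existsUnique_minimal_incomparable_subspace_cover
    (K : Type*) [Field K] [Infinite K]
    (V : Type*) [AddCommGroup V] [Module K V] [FiniteDimensional K V]
    (A : Set V) :
    ∃! 𝒮 : Finset (Submodule K V),
      (∀ S₁ ∈ 𝒮, ∀ S₂ ∈ 𝒮, S₁ ≤ S₂ → S₁ = S₂) ∧
      (A ⊆ ⋃ S ∈ 𝒮, (S : Set V)) ∧
      ∀ 𝒯 : Finset (Submodule K V), (A ⊆ ⋃ T ∈ 𝒯, (T : Set V)) →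
        (⋃ S ∈ 𝒮, (S : Set V)) ⊆ ⋃ T ∈ 𝒯, (T : Set V) := by
  obtain ⟨𝒮₀, hcover₀, hmin₀⟩ := Submodule.exists_minimal_finset_cover_inter A (⊤ : Submodule K V)
  simp only [Submodule.top_coe, Set.inter_univ] at hcover₀ hmin₀
  obtain ⟨𝒮, hinc, hunion⟩ := Submodule.exists_incomparable_biUnion_eq 𝒮₀
  rw [← hunion] at hcover₀ hmin₀
  refine ⟨𝒮, ⟨hinc, hcover₀, hmin₀⟩, fun 𝒯 ⟨hinc', hcover', hmin'⟩ ↦ ?_⟩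
  have heq := (hmin' 𝒮 hcover₀).antisymm (hmin₀ 𝒯 hcover')
  exact (Subspace.subset_of_biUnion_eq_of_incomparable hinc' heq).antisymm
    (Subspace.subset_of_biUnion_eq_of_incomparable hinc heq.symm)
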